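/- Let K, L be positive integers and let u ∈ [0,1]^K, v ∈ [0,1]^L be nonzero vectors such that either all entries of u are positive or all entries of v are positive, and such that there are indices i* and j* with u_{i*} > u_i for all i ≠ i* and v_{j*} > v_j for all j ≠ j*. Then the vector μ defined by μ_{(i,j)} = u_i v_j is unimodal with respect to the graph G1: the entry (i*, j*) is the unique maximizer of μ over [K]×[L], and for every vertex (i,j) ≠ (i*,j*) there exists a path (i,j) = p_1, p_2, …, p_m = (i*,j*) in G1 along which μ_{p_1} < μ_{p_2} < ⋯ < μ_{p_m}. -/

import Mathlib

/-- Adjacency in the graph `G1` on `[K] × [L]`: two distinct entries are neighbors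
iff they share a row or a column. -/
def G1Adj {K L : ℕ} (p q : Fin K × Fin L) : Prop :=
  p ≠ q ∧ (p.1 = q.1 ∨ p.2 = q.2)

/-- A function attaining a strict maximum at `a` and nonnegative but not identically zero is
positive at `a`. -/
theorem pos_of_strict_max {ι : Type*} {f : ι → ℝ} {a : ι} (hf : ∀ i, 0 ≤ f i) (hf0 : f ≠ 0)
    (ha : ∀ i, i ≠ a → f i < f a) : 0 < f a := by
  obtain ⟨i, hi⟩ := Function.ne_iff.mp hf0
  obtain rfl | hia := eq_or_ne i a
  · exact (hf i).lt_of_ne' hi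
  · exact (hf i).trans_lt (ha i hia)

/-- A single increasing edge, as an increasing path. -/
theorem exists_increasing_path_of_edge {V : Type*} {r : V → V → Prop} {μ : V → ℝ} {p s : V}
    (h : r p s) (hμ : μ p < μ s) :
    ∃ (m : ℕ) (q : Fin (m + 1) → V), q 0 = p ∧ q (Fin.last m) = s ∧
      (∀ i : Fin m, r (q i.castSucc) (q i.succ)) ∧
      (∀ i : Fin m, μ (q i.castSucc) < μ (q i.succ)) := by
  refine ⟨1, ![p, s], rfl, rfl, ?_, ?_⟩ <;> intro i <;> fin_cases i <;> assumption

/-- Two consecutive increasing edges, as an increasing path. -/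
theorem exists_increasing_path_of_two_edges {V : Type*} {r : V → V → Prop} {μ : V → ℝ}
    {p t s : V} (hpt : r p t) (hts : r t s) (hμpt : μ p < μ t) (hμts : μ t < μ s) :
    ∃ (m : ℕ) (q : Fin (m + 1) → V), q 0 = p ∧ q (Fin.last m) = s ∧
      (∀ i : Fin m, r (q i.castSucc) (q i.succ)) ∧
      (∀ i : Fin m, μ (q i.castSucc) < μ (q i.succ)) := by
  refine ⟨2, ![p, t, s], rfl, rfl, ?_, ?_⟩ <;> intro i <;> fin_cases i <;> assumption

/-- A rank-one bandit instance (with `u ≻ 0` or `v ≻ 0`, and unique best row and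
column) is unimodal with respect to `G1`: the entry `(i⋆, j⋆)` is the unique
maximizer of `μ (i,j) = u i * v j`, and from every other entry there is a strictly
increasing path in `G1` to `(i⋆, j⋆)`. -/
theorem rank_one_is_unimodal (K L : ℕ) (hK : 0 < K) (hL : 0 < L)
    (u : Fin K → ℝ) (v : Fin L → ℝ)
    (hu : ∀ i, u i ∈ Set.Icc (0 : ℝ) 1) (hv : ∀ j, v j ∈ Set.Icc (0 : ℝ) 1)
    (hu0 : u ≠ 0) (hv0 : v ≠ 0)
    (hpos : (∀ i, 0 < u i) ∨ (∀ j, 0 < v j))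
    (istar : Fin K) (jstar : Fin L)
    (hiu : ∀ i, i ≠ istar → u i < u istar)
    (hjv : ∀ j, j ≠ jstar → v j < v jstar) :
    (∀ p : Fin K × Fin L, p ≠ (istar, jstar) → u p.1 * v p.2 < u istar * v jstar) ∧
    (∀ p : Fin K × Fin L, p ≠ (istar, jstar) →
      ∃ (m : ℕ) (q : Fin (m + 1) → Fin K × Fin L),
        q 0 = p ∧ q (Fin.last m) = (istar, jstar) ∧
        (∀ i : Fin m, G1Adj (q i.castSucc) (q i.succ)) ∧
        (∀ i : Fin m, u (q i.castSucc).1 * v (q i.castSucc).2 <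
          u (q i.succ).1 * v (q i.succ).2)) := by
  have hus : 0 < u istar := pos_of_strict_max (fun i => (hu i).1) hu0 hiu
  have hvs : 0 < v jstar := pos_of_strict_max (fun j => (hv j).1) hv0 hjv
  have hrow : ∀ i, i ≠ istar → u i * v jstar < u istar * v jstar := fun i hi =>
    mul_lt_mul_of_pos_right (hiu i hi) hvs
  have hcol : ∀ j, j ≠ jstar → u istar * v j < u istar * v jstar := fun j hj =>
    mul_lt_mul_of_pos_left (hjv j hj) hus
  refine ⟨?_, ?_⟩
  · rintro ⟨i, j⟩ hp
    obtain rfl | hi := eq_or_ne i istar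
    · exact hcol j fun hj => hp (by rw [hj])
    · have hj : v j ≤ v jstar := by
        obtain rfl | hj := eq_or_ne j jstar
        exacts [le_rfl, (hjv j hj).le]
      exact (mul_le_mul_of_nonneg_left hj (hu i).1).trans_lt (hrow i hi)
  · rintro ⟨i, j⟩ hp
    obtain rfl | hi := eq_or_ne i istar
    · have hj : j ≠ jstar := fun hj => hp (by rw [hj])
      exact exists_increasing_path_of_edge (r := G1Adj) (μ := fun p => u p.1 * v p.2)
        ⟨hp, Or.inl rfl⟩ (hcol j hj)
    obtain rfl | hj := eq_or_ne j jstar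
    · exact exists_increasing_path_of_edge (r := G1Adj) (μ := fun p => u p.1 * v p.2)
        ⟨hp, Or.inr rfl⟩ (hrow i hi)
    rcases hpos with hup | hvp
    · exact exists_increasing_path_of_two_edges (r := G1Adj) (μ := fun p => u p.1 * v p.2)
        (t := (i, jstar)) ⟨by simp [hj], Or.inl rfl⟩ ⟨by simp [hi], Or.inr rfl⟩
        (mul_lt_mul_of_pos_left (hjv j hj) (hup i)) (hrow i hi)
    · exact exists_increasing_path_of_two_edges (r := G1Adj) (μ := fun p => u p.1 * v p.2)
        (t := (istar, j)) ⟨by simp [hi], Or.inr rfl⟩ ⟨by simp [hj], Or.inl rfl⟩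
        (mul_lt_mul_of_pos_right (hiu i hi) (hvp j)) (hcol j hj)
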